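/- Let m, ω, ħ, E > 0 and h₂ ∈ ℝ. Let f₂ : ℂ × ℂ → ℂ be entire and satisfy the heat-like equation ∂_u f₂(z,u) = −(1/(8πħmω)) ∂²_{zz} f₂(z,u). Define f(t,x₁,x₂,x₃) = (√(E+mω)/√(ix₂+E+mω)) · exp(−iωt/2 − πħE x₁² − 2πih₂x₂ − πħ(x₃ − iEx₁)²/(ix₂+E+mω)) · f₂( e^{−iωt}(x₃ − iEx₁)/(ix₂+E+mω), e^{−2iωt}(mω − ix₂ − E)/(mω + ix₂ + E) ), with principal square roots. Then f satisfies the harmonic oscillator Schrödinger equation iħ∂ₜf = Hf for all (t,x₁,x₂,x₃), where Hf = −(1/(4πm))∂₁₁f − ((x₂² + m²ω²)/(4πm))∂₃₃f − (x₂/(2πm))∂₁₃f + (iħ/m)x₃∂₁f + (iħ/m)x₂x₃∂₃f + (1/(2m))(iħx₂ + 2πħ²x₃²)f. -/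

import Mathlib

/-- Partial derivative in t of a function of (t,x₁,x₂,x₃) ∈ ℝ⁴. -/
noncomputable def pdt (F : ℝ × ℝ × ℝ × ℝ → ℂ) : ℝ × ℝ × ℝ × ℝ → ℂ :=
  fun p => deriv (fun s => F (s, p.2.1, p.2.2.1, p.2.2.2)) p.1

/-- Partial derivative in x₁ of a function of (t,x₁,x₂,x₃) ∈ ℝ⁴. -/
noncomputable def pd1 (F : ℝ × ℝ × ℝ × ℝ → ℂ) : ℝ × ℝ × ℝ × ℝ → ℂ :=
  fun p => deriv (fun s => F (p.1, s, p.2.2.1, p.2.2.2)) p.2.1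

/-- Partial derivative in x₂ of a function of (t,x₁,x₂,x₃) ∈ ℝ⁴. -/
noncomputable def pd2 (F : ℝ × ℝ × ℝ × ℝ → ℂ) : ℝ × ℝ × ℝ × ℝ → ℂ :=
  fun p => deriv (fun s => F (p.1, p.2.1, s, p.2.2.2)) p.2.2.1

/-- Partial derivative in x₃ of a function of (t,x₁,x₂,x₃) ∈ ℝ⁴. -/
noncomputable def pd3 (F : ℝ × ℝ × ℝ × ℝ → ℂ) : ℝ × ℝ × ℝ × ℝ → ℂ :=
  fun p => deriv (fun s => F (p.1, p.2.1, p.2.2.1, s)) p.2.2.2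

theorem aux_deriv (g : ℂ → ℂ) (hg : Differentiable ℂ g) (K b φ' a' z' : ℂ) (φ a z : ℝ → ℂ) (x : ℝ)
    (hφ : HasDerivAt φ φ' x) (ha : HasDerivAt a a' x) (hz : HasDerivAt z z' x) :
    HasDerivAt (fun s => K * Complex.exp (φ s) * (a s * g (z s) + b * deriv g (z s)))
      (K * Complex.exp (φ x) * ((φ' * a x + a') * g (z x) + (a x * z' + φ' * b) * deriv g (z x)
        + b * z' * deriv (deriv g) (z x))) x := by
  have hg1 : HasDerivAt (fun s => g (z s)) (deriv g (z x) * z') x :=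
    (hg (z x)).hasDerivAt.comp x hz
  have hg' : Differentiable ℂ (deriv g) := by
    have := (hg.contDiff (n := 2)).differentiable_deriv_two
    exact this
  have hg2 : HasDerivAt (fun s => deriv g (z s)) (deriv (deriv g) (z x) * z') x :=
    (hg' (z x)).hasDerivAt.comp x hz
  have := (hφ.cexp.const_mul K).mul ((ha.mul hg1).add (hg2.const_mul b))
  refine this.congr_deriv ?_
  simp only [Pi.mul_apply, Pi.add_apply]
  ring

theorem aux_chain (f₂ : ℂ × ℂ → ℂ) (hf : Differentiable ℂ f₂) (z u : ℝ → ℂ) (z' u' : ℂ) (x : ℝ)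
    (hz : HasDerivAt z z' x) (hu : HasDerivAt u u' x) :
    HasDerivAt (fun s => f₂ (z s, u s))
      (deriv (fun w => f₂ (w, u x)) (z x) * z' + deriv (fun w => f₂ (z x, w)) (u x) * u') x := by
  have hL := (hf (z x, u x)).hasFDerivAt
  have h1 : HasDerivAt (fun w => f₂ (w, u x)) (fderiv ℂ f₂ (z x, u x) (1, 0)) (z x) :=
    hL.comp_hasDerivAt (z x) ((hasDerivAt_id (z x)).prodMk (hasDerivAt_const (z x) (u x)))
  have h2 : HasDerivAt (fun w => f₂ (z x, w)) (fderiv ℂ f₂ (z x, u x) (0, 1)) (u x) :=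
    hL.comp_hasDerivAt (u x) ((hasDerivAt_const (u x) (z x)).prodMk (hasDerivAt_id (u x)))
  have h3 : HasDerivAt (fun s => f₂ (z s, u s)) (fderiv ℂ f₂ (z x, u x) (z', u')) x := by
    have hR : HasFDerivAt f₂ ((fderiv ℂ f₂ (z x, u x)).restrictScalars ℝ) (z x, u x) :=
      hL.restrictScalars ℝ
    exact HasFDerivAt.comp_hasDerivAt (f := fun s => (z s, u s)) x hR (hz.prodMk hu)
  rw [h1.deriv, h2.deriv]
  refine h3.congr_deriv ?_
  have : ((z', u') : ℂ × ℂ) = z' • ((1, 0) : ℂ × ℂ) + u' • ((0, 1) : ℂ × ℂ) := by simp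
  rw [this, map_add, map_smul, map_smul, smul_eq_mul, smul_eq_mul]
  ring

theorem alg0 (i m w h E P x y v D : ℂ) (hi : i ^ 2 = -1) (hm : m ≠ 0) (hP : P ≠ 0)
    (hD0 : D ≠ 0) (hD : D = i * y + E + m * w) (φ1 φ3 φ11 φ13 φ33 : ℂ)
    (h1 : φ1 = -(2 * P * h * E * x) + 2 * P * h * i * E * (v - i * E * x) / D)
    (h3 : φ3 = -(2 * P * h * (v - i * E * x) / D))
    (h11 : φ11 = -(2 * P * h * E) + 2 * P * h * E ^ 2 / D)
    (h13 : φ13 = 2 * P * h * i * E / D) (h33 : φ33 = -(2 * P * h / D)) :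
    h * w / 2 = -(1 / (4 * P * m)) * (φ1 * φ1 + φ11)
      - ((y ^ 2 + m ^ 2 * w ^ 2) / (4 * P * m)) * (φ3 * φ3 + φ33)
      - (y / (2 * P * m)) * (φ1 * φ3 + φ13) + (i * h / m) * v * φ1 + (i * h / m) * y * v * φ3
      + (1 / (2 * m)) * (i * h * y + 2 * P * h ^ 2 * v ^ 2) := by
  subst h1 h3 h11 h13 h33
  field_simp
  rw [hD]
  grind

theorem alg1 (i m w h E P x y v D e : ℂ) (hi : i ^ 2 = -1) (hm : m ≠ 0) (hP : P ≠ 0)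
    (hD0 : D ≠ 0) (hD : D = i * y + E + m * w) (φ1 φ3 z1 z3 : ℂ)
    (h1 : φ1 = -(2 * P * h * E * x) + 2 * P * h * i * E * (v - i * E * x) / D)
    (h3 : φ3 = -(2 * P * h * (v - i * E * x) / D))
    (hz1 : z1 = -(i * E * e / D)) (hz3 : z3 = e / D) :
    h * w * (e * (v - i * E * x) / D) = -(1 / (4 * P * m)) * (2 * φ1 * z1)
      - ((y ^ 2 + m ^ 2 * w ^ 2) / (4 * P * m)) * (2 * φ3 * z3)
      - (y / (2 * P * m)) * (φ1 * z3 + φ3 * z1) + (i * h / m) * v * z1 + (i * h / m) * y * v * z3 := by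
  subst h1 h3 hz1 hz3
  field_simp
  rw [hD]
  grind

theorem alg2 (i m w E P y D e : ℂ) (hi : i ^ 2 = -1) (hm : m ≠ 0) (hP : P ≠ 0)
    (hD0 : D ≠ 0) (hD : D = i * y + E + m * w) (z1 z3 : ℂ)
    (hz1 : z1 = -(i * E * e / D)) (hz3 : z3 = e / D) :
    -(1 / (4 * P * m)) * (e ^ 2 * (m * w - (i * y + E)) / D) = -(1 / (4 * P * m)) * (z1 * z1)
      - ((y ^ 2 + m ^ 2 * w ^ 2) / (4 * P * m)) * (z3 * z3)
      - (y / (2 * P * m)) * (z3 * z1) := by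
  subst hz1 hz3
  field_simp
  rw [hD]
  grind

theorem aux_ofReal (x : ℝ) : HasDerivAt (fun s : ℝ => (s : ℂ)) 1 x :=
  (hasDerivAt_id x).ofReal_comp

theorem stmt14 (m ω ℏ E h₂ : ℝ) (hm : 0 < m) (hω : 0 < ω) (hℏ : 0 < ℏ) (hE : 0 < E)
    (f₂ : ℂ × ℂ → ℂ) (hf₂ : Differentiable ℂ f₂)
    (hheat : ∀ z u : ℂ,
      deriv (fun w => f₂ (z, w)) u
        = -(1 / (8 * Real.pi * ℏ * m * ω)) * deriv (deriv (fun w => f₂ (w, u))) z)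
    (f : ℝ × ℝ × ℝ × ℝ → ℂ)
    (hf : f = fun p : ℝ × ℝ × ℝ × ℝ =>
      ((Real.sqrt (E + m * ω) : ℂ) / ((Complex.I * p.2.2.1 + E + m * ω) ^ ((1:ℂ)/2))) *
        Complex.exp (-(Complex.I * ω * p.1) / 2 - Real.pi * ℏ * E * p.2.1^2
          - 2 * Real.pi * Complex.I * h₂ * p.2.2.1
          - Real.pi * ℏ * (p.2.2.2 - Complex.I * E * p.2.1)^2
              / (Complex.I * p.2.2.1 + E + m * ω)) *
        f₂ (Complex.exp (-(Complex.I * ω * p.1)) * (p.2.2.2 - Complex.I * E * p.2.1)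
              / (Complex.I * p.2.2.1 + E + m * ω),
            Complex.exp (-(2 * Complex.I * ω * p.1)) *
              (m * ω - (Complex.I * p.2.2.1 + E)) / (m * ω + (Complex.I * p.2.2.1 + E)))) :
    ∀ p : ℝ × ℝ × ℝ × ℝ,
      Complex.I * ℏ * pdt f p
        = -(1 / (4 * Real.pi * m)) * pd1 (pd1 f) p
          - ((p.2.2.1^2 + m^2 * ω^2) / (4 * Real.pi * m)) * pd3 (pd3 f) p
          - (p.2.2.1 / (2 * Real.pi * m)) * pd1 (pd3 f) p
          + (Complex.I * ℏ / m) * p.2.2.2 * pd1 f p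
          + (Complex.I * ℏ / m) * p.2.2.1 * p.2.2.2 * pd3 f p
          + (1 / (2 * m)) * (Complex.I * ℏ * p.2.2.1 + 2 * Real.pi * ℏ^2 * p.2.2.2^2) * f p := by
  have hDne : ∀ y : ℝ, Complex.I * y + E + m * ω ≠ 0 := by
    intro y h0
    have := congrArg Complex.re h0
    simp at this
    nlinarith [mul_pos hm hω]
  have hmC : (m : ℂ) ≠ 0 := by exact_mod_cast hm.ne'
  have hωC : (ω : ℂ) ≠ 0 := by exact_mod_cast hω.ne'
  have hℏC : (ℏ : ℂ) ≠ 0 := by exact_mod_cast hℏ.ne'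
  have hPC : (Real.pi : ℂ) ≠ 0 := by exact_mod_cast Real.pi_ne_zero
  obtain ⟨D, hD⟩ : ∃ D : ℝ → ℂ, D = fun y : ℝ => Complex.I * y + E + m * ω := ⟨_, rfl⟩
  obtain ⟨K, hK⟩ : ∃ K : ℝ → ℂ, K = fun y : ℝ =>
    ((Real.sqrt (E + m * ω) : ℂ) / ((D y) ^ ((1:ℂ)/2))) := ⟨_, rfl⟩
  obtain ⟨φ, hφ⟩ : ∃ φ : ℝ → ℝ → ℝ → ℝ → ℂ, φ = fun t x y v : ℝ =>
    -(Complex.I * ω * t) / 2 - Real.pi * ℏ * E * x^2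
          - 2 * Real.pi * Complex.I * h₂ * y
          - Real.pi * ℏ * (v - Complex.I * E * x)^2 / D y := ⟨_, rfl⟩
  obtain ⟨Z, hZ⟩ : ∃ Z : ℝ → ℝ → ℝ → ℝ → ℂ, Z = fun t x y v : ℝ =>
    Complex.exp (-(Complex.I * ω * t)) * (v - Complex.I * E * x) / D y := ⟨_, rfl⟩
  obtain ⟨U, hU⟩ : ∃ U : ℝ → ℝ → ℂ, U = fun t y : ℝ =>
    Complex.exp (-(2 * Complex.I * ω * t)) * (m * ω - (Complex.I * y + E)) / D y := ⟨_, rfl⟩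
  have hD0 : ∀ y, D y ≠ 0 := by intro y; rw [hD]; exact hDne y
  have hf' : f = fun p : ℝ × ℝ × ℝ × ℝ => K p.2.2.1 *
      Complex.exp (φ p.1 p.2.1 p.2.2.1 p.2.2.2) *
      f₂ (Z p.1 p.2.1 p.2.2.1 p.2.2.2, U p.1 p.2.2.1) := by
    rw [hf, hK, hφ, hZ, hU, hD]
    funext p
    have : (m * ω + (Complex.I * p.2.2.1 + E) : ℂ) = Complex.I * p.2.2.1 + E + m * ω := by ring
    simp only [this]
  clear hf
  obtain ⟨φ1, hφ1⟩ : ∃ φ1 : ℝ → ℝ → ℝ → ℂ, φ1 = fun x y v : ℝ =>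
    -(2 * Real.pi * ℏ * E * x) + 2 * Real.pi * ℏ * Complex.I * E * (v - Complex.I * E * x) / D y :=
    ⟨_, rfl⟩
  obtain ⟨φ3, hφ3⟩ : ∃ φ3 : ℝ → ℝ → ℝ → ℂ, φ3 = fun x y v : ℝ =>
    -(2 * Real.pi * ℏ * (v - Complex.I * E * x) / D y) := ⟨_, rfl⟩
  obtain ⟨Z1, hZ1⟩ : ∃ Z1 : ℝ → ℝ → ℂ, Z1 = fun t y : ℝ =>
    -(Complex.I * E * Complex.exp (-(Complex.I * ω * t)) / D y) := ⟨_, rfl⟩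
  obtain ⟨Z3, hZ3⟩ : ∃ Z3 : ℝ → ℝ → ℂ, Z3 = fun t y : ℝ =>
    Complex.exp (-(Complex.I * ω * t)) / D y := ⟨_, rfl⟩
  have d1φ : ∀ t x y v, HasDerivAt (fun s => φ t s y v) (φ1 x y v) x := by
    intro t x y v
    rw [hφ, hφ1]
    have h := aux_ofReal x
    have := ((((h.pow 2).const_mul (Real.pi * ℏ * E : ℂ)).const_sub
      (-(Complex.I * ω * t) / 2)).sub_const (2 * Real.pi * Complex.I * h₂ * y : ℂ)).sub
      (((((h.const_mul (Complex.I * E)).const_sub (v : ℂ)).pow 2).const_mul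
        (Real.pi * ℏ : ℂ)).div_const (D y))
    refine this.congr_deriv ?_
    have := hD0 y
    simp
    field_simp
    ring
  have d3φ : ∀ t x y v, HasDerivAt (fun s => φ t x y s) (φ3 x y v) v := by
    intro t x y v
    rw [hφ, hφ3]
    have h := aux_ofReal v
    have := ((((h.sub_const (Complex.I * E * x)).pow 2).const_mul
        (Real.pi * ℏ : ℂ)).div_const (D y)).const_sub (-(Complex.I * ω * t) / 2
          - Real.pi * ℏ * E * x^2 - 2 * Real.pi * Complex.I * h₂ * y)
    refine this.congr_deriv ?_
    have := hD0 y
    simp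
    field_simp
  have dtφ : ∀ t x y v, HasDerivAt (fun s => φ s x y v) (-(Complex.I * ω) / 2) t := by
    intro t x y v
    rw [hφ]
    have h := aux_ofReal t
    have := (((((h.const_mul (Complex.I * ω)).neg).div_const 2).sub_const
      (Real.pi * ℏ * E * x^2 : ℂ)).sub_const (2 * Real.pi * Complex.I * h₂ * y : ℂ)).sub_const
      (Real.pi * ℏ * (v - Complex.I * E * x)^2 / D y)
    refine this.congr_deriv ?_
    simp
  have d1Z : ∀ t x y v, HasDerivAt (fun s => Z t s y v) (Z1 t y) x := by
    intro t x y v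
    rw [hZ, hZ1]
    have h := aux_ofReal x
    have := (((h.const_mul (Complex.I * E)).const_sub (v : ℂ)).const_mul
      (Complex.exp (-(Complex.I * ω * t)))).div_const (D y)
    refine this.congr_deriv ?_
    ring
  have d3Z : ∀ t x y v, HasDerivAt (fun s => Z t x y s) (Z3 t y) v := by
    intro t x y v
    rw [hZ, hZ3]
    have h := aux_ofReal v
    have := ((h.sub_const (Complex.I * E * x)).const_mul
      (Complex.exp (-(Complex.I * ω * t)))).div_const (D y)
    refine this.congr_deriv ?_
    ring
  have dtZ : ∀ t x y v, HasDerivAt (fun s => Z s x y v) (-(Complex.I * ω) * Z t x y v) t := by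
    intro t x y v
    rw [hZ]
    have h := aux_ofReal t
    have := (((h.const_mul (Complex.I * ω)).neg.cexp).mul_const
      (v - Complex.I * E * x)).div_const (D y)
    refine this.congr_deriv ?_
    simp only [Pi.neg_apply]
    ring
  have dtU : ∀ t y, HasDerivAt (fun s => U s y) (-(2 * Complex.I * ω) * U t y) t := by
    intro t y
    rw [hU]
    have h := aux_ofReal t
    have := (((h.const_mul (2 * Complex.I * ω)).neg.cexp).mul_const
      (m * ω - (Complex.I * y + E))).div_const (D y)
    refine this.congr_deriv ?_
    simp only [Pi.neg_apply]
    ring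
  have d1φ1 : ∀ x y v, HasDerivAt (fun s => φ1 s y v)
      (-(2 * Real.pi * ℏ * E) + 2 * Real.pi * ℏ * E ^ 2 / D y) x := by
    intro x y v
    rw [hφ1]
    have h := aux_ofReal x
    have := ((h.const_mul (2 * Real.pi * ℏ * E : ℂ)).neg).add
      ((((h.const_mul (Complex.I * E)).const_sub (v : ℂ)).const_mul
        (2 * Real.pi * ℏ * Complex.I * E : ℂ)).div_const (D y))
    refine this.congr_deriv ?_
    ring_nf
    simp
  have d1φ3 : ∀ x y v, HasDerivAt (fun s => φ3 s y v)
      (2 * Real.pi * ℏ * Complex.I * E / D y) x := by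
    intro x y v
    rw [hφ3]
    have h := aux_ofReal x
    have := ((((h.const_mul (Complex.I * E)).const_sub (v : ℂ)).const_mul
        (2 * Real.pi * ℏ : ℂ)).div_const (D y)).neg
    refine this.congr_deriv ?_
    ring
  have d3φ3 : ∀ x y v, HasDerivAt (fun s => φ3 x y s)
      (-(2 * Real.pi * ℏ / D y)) v := by
    intro x y v
    rw [hφ3]
    have h := aux_ofReal v
    have := (((h.sub_const (Complex.I * E * x)).const_mul
        (2 * Real.pi * ℏ : ℂ)).div_const (D y)).neg
    refine this.congr_deriv ?_
    ring
  have hg : ∀ u, Differentiable ℂ (fun w => f₂ (w, u)) := fun u =>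
    hf₂.comp (differentiable_id.prodMk (differentiable_const u))
  have p1 : pd1 f = fun p => K p.2.2.1 * Complex.exp (φ p.1 p.2.1 p.2.2.1 p.2.2.2) *
      (φ1 p.2.1 p.2.2.1 p.2.2.2 * f₂ (Z p.1 p.2.1 p.2.2.1 p.2.2.2, U p.1 p.2.2.1)
        + Z1 p.1 p.2.2.1 * deriv (fun w => f₂ (w, U p.1 p.2.2.1)) (Z p.1 p.2.1 p.2.2.1 p.2.2.2)) := by
    funext ⟨t, x, y, v⟩
    have := (aux_deriv _ (hg (U t y)) (K y) 0 _ _ _ _ _ _ x (d1φ t x y v)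
      (hasDerivAt_const x (1 : ℂ)) (d1Z t x y v)).deriv
    simp only [one_mul, zero_mul, add_zero, mul_zero, mul_one] at this
    simp only [pd1, hf']
    exact this
  have p3 : pd3 f = fun p => K p.2.2.1 * Complex.exp (φ p.1 p.2.1 p.2.2.1 p.2.2.2) *
      (φ3 p.2.1 p.2.2.1 p.2.2.2 * f₂ (Z p.1 p.2.1 p.2.2.1 p.2.2.2, U p.1 p.2.2.1)
        + Z3 p.1 p.2.2.1 * deriv (fun w => f₂ (w, U p.1 p.2.2.1)) (Z p.1 p.2.1 p.2.2.1 p.2.2.2)) := by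
    funext ⟨t, x, y, v⟩
    have := (aux_deriv _ (hg (U t y)) (K y) 0 _ _ _ _ _ _ v (d3φ t x y v)
      (hasDerivAt_const v (1 : ℂ)) (d3Z t x y v)).deriv
    simp only [one_mul, zero_mul, add_zero, mul_zero, mul_one] at this
    simp only [pd3, hf']
    exact this
  rintro ⟨t, x, y, v⟩
  have q11 := (aux_deriv _ (hg (U t y)) (K y) (Z1 t y) _ _ _ _ _ _ x (d1φ t x y v)
      (d1φ1 x y v) (d1Z t x y v)).deriv
  have q13 := (aux_deriv _ (hg (U t y)) (K y) (Z3 t y) _ _ _ _ _ _ x (d1φ t x y v)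
      (d1φ3 x y v) (d1Z t x y v)).deriv
  have q33 := (aux_deriv _ (hg (U t y)) (K y) (Z3 t y) _ _ _ _ _ _ v (d3φ t x y v)
      (d3φ3 x y v) (d3Z t x y v)).deriv
  have qt := (((dtφ t x y v).cexp.const_mul (K y)).mul
    (aux_chain f₂ hf₂ _ _ _ _ t (dtZ t x y v) (dtU t y))).deriv
  have et : pdt f (t, x, y, v) = deriv ((fun s => K y * Complex.exp (φ s x y v)) *
      fun s => f₂ (Z s x y v, U s y)) t := by
    simp only [pdt, hf']; rfl
  rw [et, qt, p1, p3]
  simp only [pd1, pd3]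
  rw [q11, q13, q33, hf', hheat]
  beta_reduce
  have a0 := alg0 Complex.I m ω ℏ E Real.pi x y v (D y) Complex.I_sq hmC hPC (hD0 y) (by rw [hD])
    (φ1 x y v) (φ3 x y v) _ _ _ (by rw [hφ1]) (by rw [hφ3]) rfl rfl rfl
  have a1 := alg1 Complex.I m ω ℏ E Real.pi x y v (D y) (Complex.exp (-(Complex.I * ω * t)))
    Complex.I_sq hmC hPC (hD0 y) (by rw [hD])
    (φ1 x y v) (φ3 x y v) (Z1 t y) (Z3 t y) (by rw [hφ1]) (by rw [hφ3]) (by rw [hZ1]) (by rw [hZ3])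
  have a2 := alg2 Complex.I m ω E Real.pi y (D y) (Complex.exp (-(Complex.I * ω * t)))
    Complex.I_sq hmC hPC (hD0 y) (by rw [hD])
    (Z1 t y) (Z3 t y) (by rw [hZ1]) (by rw [hZ3])
  have eZ : Complex.exp (-(Complex.I * ω * t)) * (v - Complex.I * E * x) / D y = Z t x y v := by
    rw [hZ]
  have eU : Complex.exp (-(Complex.I * ω * t)) ^ 2 * (m * ω - (Complex.I * y + E)) / D y
      = U t y := by
    rw [hU, ← Complex.exp_nat_mul]
    congr 3
    push_cast
    ring_nf
  rw [eZ] at a1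
  rw [eU] at a2
  have hc : Complex.I * ℏ * (-(1 / (8 * Real.pi * ℏ * m * ω))) * (-(2 * Complex.I * ω))
      = -(1 / (4 * Real.pi * m) : ℂ) := by
    field_simp
    rw [Complex.I_sq]
    norm_num
  dsimp only
  generalize f₂ (Z t x y v, U t y) = g0
  generalize deriv (deriv fun w => f₂ (w, U t y)) (Z t x y v) = g2
  generalize deriv (fun w => f₂ (w, U t y)) (Z t x y v) = g1
  generalize Complex.exp (φ t x y v) = e at *
  linear_combination (K y * e * g0) * a0 + (K y * e * g1) * a1 + (K y * e * g2) * a2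
    + (K y * e * g2 * U t y) * hc
    - (K y * e * (ℏ * ω / 2 * g0 + ℏ * ω * Z t x y v * g1)) * Complex.I_sq
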